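/- Totality of context-free languages is undecidable, hence the free energy G_U(L') (with U = 0) of the language L' = (Σ* − L)Σ* is not computable as a function of a context-free grammar for L. -/

import Mathlib

open Filter

/-- `(Σ* − L)·Σ*`: the words having a prefix not in `L`. -/
def compCat {σ : Type*} (L : Set (List σ)) : Set (List σ) :=
  {w | ∃ u v : List σ, u ∉ L ∧ w = u ++ v}

/-- Free energy with zero cost function: growth rate of the number of words of length n. -/
noncomputable def freeEnergyZero {σ : Type*} (K : Set (List σ)) : ℝ :=
  limsup (fun n : ℕ =>
    (1 / (n : ℝ)) * Real.log (Nat.card {w : List σ // w ∈ K ∧ w.length = n})) atTop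

/-- An encoding of context-free grammars over the binary alphabet `Fin 2` with
nonterminals drawn from `ℕ`: a start nonterminal together with a list of rules,
where a rule maps a nonterminal to a string of nonterminals/terminals. -/
abbrev EncCFG : Type := ℕ × List (ℕ × List (ℕ ⊕ Fin 2))

/-- The context-free grammar denoted by an encoded grammar. -/
noncomputable def toCFG (G : EncCFG) : ContextFreeGrammar (Fin 2) :=
  letI := Classical.decEq (ContextFreeRule (Fin 2) ℕ)
  ⟨ℕ, G.1,
    (G.2.map (fun r =>
      ⟨r.1, r.2.map (Sum.elim Symbol.nonterminal Symbol.terminal)⟩)).toFinset⟩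

namespace Language

variable {α : Type*} {L M : Language α}

theorem IsRegular.singleton (x : List α) : ({x} : Language α).IsRegular := by
  refine .of_finite_range_leftQuotient ?_
  refine ((Set.finite_singleton (0 : Language α)).union
    ((List.finite_toSet x.tails).image fun y => ({y} : Language α))).subset ?_
  rintro _ ⟨w, rfl⟩
  by_cases h : w <+: x
  · obtain ⟨y, rfl⟩ := h
    refine Or.inr ⟨y, by simp, ?_⟩
    ext z
    change z = y ↔ w ++ z = w ++ y
    simp
  · left
    refine Set.eq_empty_iff_forall_notMem.2 fun z hz => h ⟨z, ?_⟩
    exact hz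

theorem IsRegular.mul (hL : L.IsRegular) (hM : M.IsRegular) : (L * M).IsRegular := by
  refine .of_finite_range_leftQuotient ?_
  refine ((hL.finite_range_leftQuotient.prod
    hM.finite_range_leftQuotient.finite_subsets).image
      fun p : Language α × Set (Language α) => p.1 * M + sSup p.2).subset ?_
  rintro _ ⟨w, rfl⟩
  refine ⟨(L.leftQuotient w, {Q | ∃ x ∈ L, ∃ y, x ++ y = w ∧ M.leftQuotient y = Q}),
    ⟨⟨w, rfl⟩, ?_⟩, ?_⟩
  · rintro _ ⟨x, -, y, -, rfl⟩
    exact ⟨y, rfl⟩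
  · ext v
    rw [mem_leftQuotient, mem_add, mem_mul, mem_mul]
    constructor
    · rintro (⟨a, ha, b, hb, rfl⟩ | ⟨_, ⟨x, hx, y, rfl, rfl⟩, hv⟩)
      · exact ⟨w ++ a, ha, b, hb, by simp⟩
      · exact ⟨x, hx, y ++ v, hv, by simp⟩
    · rintro ⟨a, ha, b, hb, hab⟩
      obtain ⟨c, rfl, rfl⟩ | ⟨c, rfl, rfl⟩ := List.append_eq_append_iff.1 hab
      · exact Or.inr ⟨_, ⟨a, ha, c, rfl, rfl⟩, hb⟩
      · exact Or.inl ⟨c, ha, b, hb, rfl⟩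

theorem append_mem_kstar {w v : List α} (hw : w ≠ []) (h : w ++ v ∈ KStar.kstar L) :
    ∃ x ∈ KStar.kstar L, ∃ y v₁ v₂, x ++ y = w ∧ v₁ ++ v₂ = v ∧ y ++ v₁ ∈ L ∧
      v₂ ∈ KStar.kstar L := by
  rw [mem_kstar] at h
  obtain ⟨S, hS, hSL⟩ := h
  induction S generalizing w with
  | nil => simp_all
  | cons a S ih =>
    rw [List.flatten_cons] at hS
    have hSL' : ∀ y ∈ S, y ∈ L := fun y hy => hSL y (List.mem_cons_of_mem _ hy)
    have ha : a ∈ L := hSL a List.mem_cons_self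
    have key : ∀ c, a = w ++ c → v = c ++ S.flatten → _ := fun c hc hv =>
      (⟨[], nil_mem_kstar L, w, c, S.flatten, rfl, hv.symm, hc ▸ ha,
        join_mem_kstar hSL'⟩ : ∃ x ∈ KStar.kstar L, ∃ y v₁ v₂, x ++ y = w ∧ v₁ ++ v₂ = v ∧
          y ++ v₁ ∈ L ∧ v₂ ∈ KStar.kstar L)
    obtain ⟨c, hc, hv⟩ | ⟨c, rfl, hv⟩ := List.append_eq_append_iff.1 hS
    · exact key c hc hv
    · rcases eq_or_ne c [] with rfl | hne
      · exact key [] (by simp) (by simpa using hv.symm)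
      · obtain ⟨x, hx, y, v₁, v₂, rfl, rfl, hy, hv₂⟩ := ih hne hv.symm hSL'
        obtain ⟨T, rfl, hT⟩ := mem_kstar.1 hx
        refine ⟨a ++ T.flatten, ?_, y, v₁, v₂, by simp, rfl, hy, hv₂⟩
        exact mem_kstar.2 ⟨a :: T, by simp, by simpa using ⟨ha, hT⟩⟩

theorem IsRegular.kstar (hL : L.IsRegular) : (KStar.kstar L).IsRegular := by
  refine .of_finite_range_leftQuotient ?_
  refine ((Set.finite_singleton (KStar.kstar L)).union
    (hL.finite_range_leftQuotient.finite_subsets.image fun S : Set (Language α) =>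
      (⋃₀ ((· * KStar.kstar L) '' S) : Set (List α)))).subset ?_
  rintro _ ⟨w, rfl⟩
  rcases eq_or_ne w [] with rfl | hw
  · exact Or.inl rfl
  refine Or.inr ⟨{Q | ∃ x ∈ KStar.kstar L, ∃ y, x ++ y = w ∧ L.leftQuotient y = Q}, ?_, ?_⟩
  · rintro _ ⟨x, -, y, -, rfl⟩
    exact ⟨y, rfl⟩
  · ext v
    constructor
    · rintro ⟨_, ⟨_, ⟨x, hx, y, rfl, rfl⟩, rfl⟩, v₁, hv₁, v₂, hv₂, rfl⟩
      obtain ⟨S, rfl, hS⟩ := mem_kstar.1 hx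
      obtain ⟨T, rfl, hT⟩ := mem_kstar.1 hv₂
      refine mem_kstar.2 ⟨S ++ (y ++ v₁) :: T, by simp, ?_⟩
      intro z hz
      simp only [List.mem_append, List.mem_cons] at hz
      rcases hz with hz | rfl | hz
      exacts [hS z hz, hv₁, hT z hz]
    · intro h
      obtain ⟨x, hx, y, v₁, v₂, rfl, rfl, hy, hv₂⟩ := append_mem_kstar hw h
      exact ⟨_, ⟨_, ⟨x, hx, y, rfl, rfl⟩, rfl⟩, v₁, hy, v₂, hv₂, rfl⟩

end Language

namespace ContextFreeGrammar

variable {T : Type*}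

/-- The language denoted by a symbol when the nonterminals are interpreted by `I`. -/
def symbolLanguage {N : Type*} (I : N → Language T) : Symbol T N → Language T
  | .terminal a => {[a]}
  | .nonterminal A => I A

theorem self_mem_prod_terminal {N : Type*} (I : N → Language T) (w : List T) :
    w ∈ ((w.map Symbol.terminal).map (symbolLanguage I)).prod := by
  induction w with
  | nil => exact rfl
  | cons a w ih => exact ⟨[a], rfl, w, ih, rfl⟩

variable (g : ContextFreeGrammar T)

/-- The terminal words derivable from a given nonterminal. -/
def languageFrom (A : g.NT) : Language T :=
  {w | g.Derives [.nonterminal A] (w.map .terminal)}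

variable {g}

theorem derives_of_mem_prod {u : List (Symbol T g.NT)} {w : List T}
    (h : w ∈ (u.map (symbolLanguage g.languageFrom)).prod) :
    g.Derives u (w.map .terminal) := by
  induction u generalizing w with
  | nil =>
    obtain rfl : w = [] := h
    exact .refl _
  | cons x u ih =>
    obtain ⟨a, ha, b, hb, rfl⟩ := h
    rw [List.map_append]
    have hx : g.Derives [x] (a.map .terminal) := by
      cases x with
      | terminal t =>
        obtain rfl : a = [t] := ha
        exact .refl _
      | nonterminal A => exact ha
    exact (hx.append_right u).trans ((ih hb).append_left _)

theorem prod_le_languageFrom {r : ContextFreeRule T g.NT} (hr : r ∈ g.rules) :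
    (r.output.map (symbolLanguage g.languageFrom)).prod ≤ g.languageFrom r.input := fun _ hw =>
  Produces.trans_derives ⟨r, hr, ContextFreeRule.Rewrites.input_output⟩ (derives_of_mem_prod hw)

theorem languageFrom_le {I : g.NT → Language T}
    (hI : ∀ r ∈ g.rules, (r.output.map (symbolLanguage I)).prod ≤ I r.input) (A : g.NT) :
    g.languageFrom A ≤ I A := by
  have key : ∀ u v, g.Derives u v →
      (v.map (symbolLanguage I)).prod ≤ (u.map (symbolLanguage I)).prod := by
    intro u v h
    induction h with
    | refl => exact le_rfl
    | tail _ h ih =>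
      refine le_trans ?_ ih
      obtain ⟨r, hr, h⟩ := h
      obtain ⟨p, q, rfl, rfl⟩ := h.exists_parts
      simp only [List.map_append, List.prod_append]
      gcongr
      simpa [symbolLanguage] using hI r hr
  intro w hw
  simpa [symbolLanguage] using key _ _ hw (self_mem_prod_terminal I w)

end ContextFreeGrammar

/-- The elementary actions on a family of counters: adding or subtracting one, and testing for
zero. -/
inductive CounterAction
  | move (up : Bool) (k : ℕ)
  | test (k : ℕ)

namespace CounterAction

open Function

/-- The effect of an action on the counters. -/
def Step : CounterAction → (ℕ → ℕ) → (ℕ → ℕ) → Prop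
  | move true k, s, s₁ => s₁ = update s k (s k + 1)
  | move false k, s, s₁ => s k ≠ 0 ∧ s₁ = update s k (s k - 1)
  | test k, s, s₁ => s k = 0 ∧ s₁ = s

/-- The effect of a sequence of actions on the counters. -/
def Run : List CounterAction → (ℕ → ℕ) → (ℕ → ℕ) → Prop
  | [], s, s' => s' = s
  | a :: t, s, s' => ∃ s₁, a.Step s s₁ ∧ Run t s₁ s'

theorem run_append {t u : List CounterAction} {s s' : ℕ → ℕ} :
    Run (t ++ u) s s' ↔ ∃ s₁, Run t s s₁ ∧ Run u s₁ s' := by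
  induction t generalizing s with
  | nil => simp [Run]
  | cons a t ih =>
    simp only [List.cons_append, Run, ih]
    tauto

end CounterAction

/-- Nondeterministic structured programs over counter actions. -/
inductive CounterProgram
  | act (a : CounterAction)
  | seq (p q : CounterProgram)
  | star (p : CounterProgram)

namespace CounterProgram

open Function CounterAction Computability

/-- The sequences of actions a program may perform. -/
def traces : CounterProgram → Language CounterAction
  | act a => {[a]}
  | seq p q => p.traces * q.traces
  | star p => p.traces∗

/-- The input-output relation of a program. -/
def Rel (p : CounterProgram) (s s' : ℕ → ℕ) : Prop := ∃ t ∈ p.traces, Run t s s'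

variable {p q : CounterProgram} {s s' : ℕ → ℕ}

theorem rel_act {a : CounterAction} : (act a).Rel s s' ↔ a.Step s s' := by
  constructor
  · rintro ⟨_, rfl, s₁, h, rfl⟩
    exact h
  · exact fun h => ⟨[a], rfl, s', h, rfl⟩

theorem rel_seq : (seq p q).Rel s s' ↔ ∃ s₁, p.Rel s s₁ ∧ q.Rel s₁ s' := by
  constructor
  · rintro ⟨_, ⟨t, ht, u, hu, rfl⟩, h⟩
    obtain ⟨s₁, h₁, h₂⟩ := run_append.1 h
    exact ⟨s₁, ⟨t, ht, h₁⟩, ⟨u, hu, h₂⟩⟩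
  · rintro ⟨s₁, ⟨t, ht, h₁⟩, ⟨u, hu, h₂⟩⟩
    exact ⟨_, ⟨t, ht, u, hu, rfl⟩, run_append.2 ⟨s₁, h₁, h₂⟩⟩

theorem rel_star_refl : (star p).Rel s s := ⟨[], Language.nil_mem_kstar _, rfl⟩

theorem rel_star_head {s₁ : ℕ → ℕ} (h : p.Rel s s₁) (h' : (star p).Rel s₁ s') :
    (star p).Rel s s' := by
  obtain ⟨t, ht, h⟩ := h
  obtain ⟨_, ⟨S, rfl, hS⟩, h'⟩ := h'
  exact ⟨_, ⟨t :: S, rfl, by simpa using ⟨ht, hS⟩⟩, run_append.2 ⟨s₁, h, h'⟩⟩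

theorem rel_star_invariant {I : (ℕ → ℕ) → Prop} (hI : ∀ s s', I s → p.Rel s s' → I s')
    (hs : I s) (h : (star p).Rel s s') : I s' := by
  obtain ⟨_, ⟨S, rfl, hS⟩, h⟩ := h
  induction S generalizing s with
  | nil =>
    obtain rfl : s' = s := h
    exact hs
  | cons t S ih =>
    obtain ⟨s₁, h₁, h₂⟩ := run_append.1 h
    exact ih (hI s s₁ hs ⟨t, hS t List.mem_cons_self, h₁⟩)
      (fun y hy => hS y (List.mem_cons_of_mem _ hy)) h₂

theorem exists_rel_star {I : (ℕ → ℕ) → Prop} (μ : (ℕ → ℕ) → ℕ)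
    (hI : ∀ s, I s → μ s ≠ 0 → ∃ s', p.Rel s s' ∧ I s' ∧ μ s' < μ s) (hs : I s) :
    ∃ s', (star p).Rel s s' ∧ I s' ∧ μ s' = 0 := by
  induction h : μ s using Nat.strong_induction_on generalizing s with
  | _ n ih =>
    by_cases h0 : μ s = 0
    · exact ⟨s, rel_star_refl, hs, h0⟩
    · obtain ⟨s₁, h₁, hs₁, hlt⟩ := hI s hs h0
      obtain ⟨s₂, h₂, hs₂⟩ := ih _ (h ▸ hlt) hs₁ rfl
      exact ⟨s₂, rel_star_head h₁ h₂, hs₂⟩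

/-- Increment a counter. -/
def inc (k : ℕ) : CounterProgram := act (move true k)

/-- Decrement a nonzero counter. -/
def dec (k : ℕ) : CounterProgram := act (move false k)

/-- Continue only if the counter is zero. -/
def isZero (k : ℕ) : CounterProgram := act (test k)

theorem rel_inc {k : ℕ} : (inc k).Rel s s' ↔ s' = update s k (s k + 1) := rel_act

theorem rel_dec {k : ℕ} : (dec k).Rel s s' ↔ s k ≠ 0 ∧ s' = update s k (s k - 1) := rel_act

theorem rel_isZero {k : ℕ} : (isZero k).Rel s s' ↔ s k = 0 ∧ s' = s := rel_act

/-- Set a counter to zero. -/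
def clear (k : ℕ) : CounterProgram := seq (star (dec k)) (isZero k)

theorem rel_clear {k : ℕ} : (clear k).Rel s s' ↔ s' = update s k 0 := by
  simp only [clear, rel_seq, rel_isZero]
  constructor
  · rintro ⟨_, h, h0, rfl⟩
    have : ∀ r ≠ k, s' r = s r := by
      refine rel_star_invariant (I := fun s' => ∀ r ≠ k, s' r = s r) ?_ (fun _ _ => rfl) h
      intro s₁ s₂ h₁ h r hr
      obtain ⟨-, rfl⟩ := rel_dec.1 h
      simp [hr, h₁ r hr]
    exact eq_update_iff.2 ⟨h0, this⟩
  · rintro rfl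
    obtain ⟨s₁, h, h₁, h0⟩ := exists_rel_star (p := dec k) (s := s)
      (I := fun s' => ∀ r ≠ k, s' r = s r) (fun s => s k) (fun s₁ h₁ h0 =>
        ⟨_, rel_dec.2 ⟨h0, rfl⟩, fun r hr => by simp [hr, h₁ r hr], by simp; omega⟩)
      (fun _ _ => rfl)
    exact ⟨s₁, h, h0, (eq_update_iff.2 ⟨h0, h₁⟩).symm⟩

/-- Move the contents of counter `a`, adding them to both `b` and `c`. -/
def distribute (a b c : ℕ) : CounterProgram :=
  seq (star (seq (dec a) (seq (inc b) (inc c)))) (isZero a)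

theorem rel_distribute {a b c : ℕ} (hab : a ≠ b) (hac : a ≠ c) (hbc : b ≠ c) :
    (distribute a b c).Rel s s' ↔
      s' = update (update (update s a 0) b (s b + s a)) c (s c + s a) := by
  have body : ∀ s₁ s₂, (seq (dec a) (seq (inc b) (inc c))).Rel s₁ s₂ ↔ s₁ a ≠ 0 ∧
      s₂ = update (update (update s₁ a (s₁ a - 1)) b (s₁ b + 1)) c (s₁ c + 1) := by
    intro s₁ s₂
    simp only [rel_seq, rel_dec, rel_inc]
    constructor
    · rintro ⟨_, ⟨h, rfl⟩, _, rfl, rfl⟩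
      simp [h, hab.symm, hac.symm, hbc.symm]
    · rintro ⟨h, rfl⟩
      exact ⟨_, ⟨h, rfl⟩, _, rfl, by simp [hab.symm, hac.symm, hbc.symm]⟩
  let I : (ℕ → ℕ) → Prop := fun s' => s' a + s' b = s a + s b ∧ s' a + s' c = s a + s c ∧
    ∀ r, r ≠ a → r ≠ b → r ≠ c → s' r = s r
  have hI : ∀ s₁ s₂, I s₁ → (seq (dec a) (seq (inc b) (inc c))).Rel s₁ s₂ → I s₂ := by
    rintro s₁ s₂ ⟨h₁, h₂, h₃⟩ h
    obtain ⟨h0, rfl⟩ := (body _ _).1 h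
    refine ⟨?_, ?_, fun r ha hb hc => by simp [ha, hb, hc, h₃]⟩
    · simp [hab, hac, hbc]; omega
    · simp [hab, hac]; omega
  have hs : I s := ⟨rfl, rfl, fun _ _ _ _ => rfl⟩
  have final : ∀ s', I s' → s' a = 0 →
      s' = update (update (update s a 0) b (s b + s a)) c (s c + s a) := by
    rintro s' ⟨h₁, h₂, h₃⟩ h0
    funext r
    by_cases hc : r = c
    · subst hc; simp; omega
    by_cases hb : r = b
    · subst hb; simp [hbc]; omega
    by_cases ha : r = a
    · subst ha; simp [hab, hac, h0]
    simp [ha, hb, hc, h₃]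
  simp only [distribute, rel_seq (q := isZero a), rel_isZero]
  constructor
  · rintro ⟨_, h, h0, rfl⟩
    exact final _ (rel_star_invariant hI hs h) h0
  · rintro rfl
    obtain ⟨s₁, h, h₁, h0⟩ := exists_rel_star (fun s => s a) (fun s₁ h₁ h0 => by
      refine ⟨_, (body _ _).2 ⟨h0, rfl⟩, hI _ _ h₁ ((body _ _).2 ⟨h0, rfl⟩), ?_⟩
      simp [hab, hac]; omega) hs
    exact ⟨s₁, h, h0, (final _ h₁ h0).symm⟩

/-- Copy counter `a` to `b` using the scratch counters `c` and `d`. -/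
def copy (a b c d : ℕ) : CounterProgram :=
  seq (clear b) (seq (clear c) (seq (distribute a b c) (distribute c a d)))

theorem rel_copy {a b c d : ℕ} (h : [a, b, c, d].Nodup) :
    (copy a b c d).Rel s s' ↔ s' = update (update (update s b (s a)) c 0) d (s d + s a) := by
  simp only [List.nodup_cons, List.mem_cons, List.not_mem_nil, or_false, not_or] at h
  obtain ⟨⟨hab, hac, had⟩, ⟨hbc, hbd⟩, hcd, -⟩ := h
  simp only [copy, rel_seq, rel_clear, rel_distribute hab hac hbc,
    rel_distribute (Ne.symm hac) hcd had, exists_eq_left]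
  refine Eq.congr_right ?_
  funext r
  by_cases hrd : r = d
  · subst hrd; simp [Ne.symm had, Ne.symm hbd, Ne.symm hcd, hac, hbc, hab]
  by_cases hra : r = a
  · subst hra; simp [had, hac, hab, hbc]
  by_cases hrc : r = c
  · subst hrc; simp [hcd, Ne.symm hac]
  by_cases hrb : r = b
  · subst hrb; simp [hbd, hbc, Ne.symm hab, hac, hab]
  simp [hra, hrb, hrc, hrd]

/-- `p` computes `f` from the counters `ins` into the counter `out`, and changes no other counter
below `m`. -/
def ComputesAt {n : ℕ} (p : CounterProgram) (f : List.Vector ℕ n →. ℕ) (m : ℕ) (ins : Fin n → ℕ)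
    (out : ℕ) : Prop :=
  ∀ s, (∀ s', p.Rel s s' → (∀ r < m, r ≠ out → s' r = s r) ∧
      s' out ∈ f (List.Vector.ofFn (s ∘ ins))) ∧
    ((f (List.Vector.ofFn (s ∘ ins))).Dom → ∃ s₁, p.Rel s s₁)

/-- `f` can be computed by counter programs. -/
def Computable {n : ℕ} (f : List.Vector ℕ n →. ℕ) : Prop :=
  ∀ (m : ℕ) (ins : Fin n → ℕ) (out : ℕ), (∀ i, ins i < m) → out < m → (∀ i, ins i ≠ out) →
    ∃ p : CounterProgram, p.ComputesAt f m ins out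

theorem computable_zero : Computable (n := 0) fun _ => Part.some 0 := by
  intro m ins out _ hout _
  refine ⟨clear out, fun s => ⟨?_, fun _ => ⟨_, rel_clear.2 rfl⟩⟩⟩
  intro s' h
  obtain rfl := rel_clear.1 h
  exact ⟨fun r _ hr => by simp [hr], by simp⟩

theorem computable_get {n : ℕ} (i : Fin n) :
    Computable fun v : List.Vector ℕ n => Part.some (v.get i) := by
  intro m ins out hins hout hne
  have hnd : [ins i, out, m, m + 1].Nodup := by
    have := hins i; have := hne i
    simp; omega
  refine ⟨copy (ins i) out m (m + 1), fun s => ⟨?_, fun _ => ⟨_, (rel_copy hnd).2 rfl⟩⟩⟩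
  intro s' h
  obtain rfl := (rel_copy hnd).1 h
  have h₁ : out ≠ m := by omega
  have h₂ : out ≠ m + 1 := by omega
  refine ⟨fun r hr hro => ?_, by simp [h₁, h₂]⟩
  have h₁ : r ≠ m := by omega
  have h₂ : r ≠ m + 1 := by omega
  simp [h₁, h₂, hro]

theorem computable_succ : Computable (n := 1) fun v => Part.some v.head.succ := by
  intro m ins out hins hout hne
  obtain ⟨p, hp⟩ := computable_get 0 m ins out hins hout hne
  refine ⟨seq p (inc out), fun s => ⟨?_, fun _ => ?_⟩⟩
  · intro s' h
    obtain ⟨s₁, h₁, h₂⟩ := rel_seq.1 h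
    obtain rfl := rel_inc.1 h₂
    obtain ⟨hf, ho⟩ := (hp s).1 _ h₁
    refine ⟨fun r hr hro => by simp [hro, hf r hr hro], ?_⟩
    simpa using ho
  · obtain ⟨s', h⟩ := (hp s).2 trivial
    exact ⟨_, rel_seq.2 ⟨s', h, rel_inc.2 rfl⟩⟩

theorem exists_compute_family {n k : ℕ} {g : Fin n → List.Vector ℕ k →. ℕ}
    (hg : ∀ i, Computable (g i)) {m : ℕ} {ins : Fin k → ℕ} (hins : ∀ i, ins i < m) (j : ℕ) :
    ∃ p : CounterProgram, ∀ s, (∀ s', p.Rel s s' → (∀ r < m, s' r = s r) ∧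
        ∀ i : Fin n, (i : ℕ) < j → s' (m + i) ∈ g i (List.Vector.ofFn (s ∘ ins))) ∧
      ((∀ i, (g i (List.Vector.ofFn (s ∘ ins))).Dom) → ∃ s', p.Rel s s') := by
  induction j with
  | zero =>
    refine ⟨clear m, fun s => ⟨fun s' h => ?_, fun _ => ⟨_, rel_clear.2 rfl⟩⟩⟩
    obtain rfl := rel_clear.1 h
    exact ⟨fun r hr => by simp [hr.ne], by simp⟩
  | succ j ih =>
    obtain ⟨p, hp⟩ := ih
    by_cases hj : j < n
    · obtain ⟨q, hq⟩ := hg ⟨j, hj⟩ (m + n) ins (m + j) (fun i => by have := hins i; omega)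
        (by omega) (fun i => by have := hins i; omega)
      have hins' : ∀ s s', p.Rel s s' → s' ∘ ins = s ∘ ins := fun s s' h =>
        funext fun i => ((hp s).1 _ h).1 _ (hins i)
      refine ⟨seq p q, fun s => ⟨fun s' h => ?_, fun hd => ?_⟩⟩
      · obtain ⟨s₁, h₁, h₂⟩ := rel_seq.1 h
        obtain ⟨hf₁, ho₁⟩ := (hp s).1 _ h₁
        obtain ⟨hf₂, ho₂⟩ := (hq s₁).1 _ h₂
        rw [hins' _ _ h₁] at ho₂
        refine ⟨fun r hr => (hf₂ r (by omega) (by omega)).trans (hf₁ r hr), fun i hi => ?_⟩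
        rcases Nat.lt_succ_iff_lt_or_eq.1 hi with hi | rfl
        · rw [hf₂ _ (by omega) (by omega)]
          exact ho₁ i hi
        · exact ho₂
      · obtain ⟨s₁, h₁⟩ := (hp s).2 hd
        obtain ⟨s₂, h₂⟩ := (hq s₁).2 (by rw [hins' _ _ h₁]; exact hd _)
        exact ⟨s₂, rel_seq.2 ⟨s₁, h₁, h₂⟩⟩
    · refine ⟨p, fun s => ⟨fun s' h => ⟨((hp s).1 _ h).1, fun i _ => ?_⟩, (hp s).2⟩⟩
      exact ((hp s).1 _ h).2 i (by omega)

theorem Computable.comp {n k : ℕ} {f : List.Vector ℕ n →. ℕ} {g : Fin n → List.Vector ℕ k →. ℕ}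
    (hf : Computable f) (hg : ∀ i, Computable (g i)) {h : List.Vector ℕ k →. ℕ}
    (hh : ∀ v y, y ∈ h v ↔ ∃ w : Fin n → ℕ, (∀ i, w i ∈ g i v) ∧ y ∈ f (List.Vector.ofFn w)) :
    Computable h := by
  intro m ins out hins hout hne
  obtain ⟨p, hp⟩ := exists_compute_family hg (m := m) hins n
  obtain ⟨q, hq⟩ := hf (m + n) (fun i => m + i) out (by simp) (by omega) (fun i => by omega)
  refine ⟨seq p q, fun s => ⟨fun s' h => ?_, fun hd => ?_⟩⟩
  · obtain ⟨s₁, h₁, h₂⟩ := rel_seq.1 h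
    obtain ⟨hf₁, ho₁⟩ := (hp s).1 _ h₁
    obtain ⟨hf₂, ho₂⟩ := (hq s₁).1 _ h₂
    exact ⟨fun r hr hro => (hf₂ r (by omega) hro).trans (hf₁ r hr),
      (hh _ _).2 ⟨_, fun i => ho₁ i i.2, ho₂⟩⟩
  · obtain ⟨y, hy⟩ := Part.dom_iff_mem.1 hd
    obtain ⟨w, hw, hy⟩ := (hh _ _).1 hy
    obtain ⟨s₁, h₁⟩ := (hp s).2 fun i => Part.dom_iff_mem.2 ⟨_, hw i⟩
    have : s₁ ∘ (fun i : Fin n => m + (i : ℕ)) = w :=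
      funext fun i => Part.mem_unique (((hp s).1 _ h₁).2 i i.2) (hw i)
    obtain ⟨s₂, h₂⟩ := (hq s₁).2 (by rw [this]; exact Part.dom_iff_mem.2 ⟨y, hy⟩)
    exact ⟨s₂, rel_seq.2 ⟨s₁, h₁, h₂⟩⟩

theorem copy_spec {a b c d : ℕ} (hnd : [a, b, c, d].Nodup) (h : (copy a b c d).Rel s s') :
    s' b = s a ∧ ∀ r, r ≠ b → r ≠ c → r ≠ d → s' r = s r := by
  obtain rfl := (rel_copy hnd).1 h
  simp only [List.nodup_cons, List.mem_cons, List.not_mem_nil, or_false, not_or] at hnd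
  exact ⟨by simp [hnd], fun r hb hc hd => by simp [hb, hc, hd]⟩

theorem Computable.prec {n : ℕ} {f : List.Vector ℕ n → ℕ} {g : List.Vector ℕ (n + 2) → ℕ}
    (hf : Computable fun v => Part.some (f v)) (hg : Computable fun v => Part.some (g v)) :
    Computable fun v : List.Vector ℕ (n + 1) => Part.some
      (v.head.rec (f v.tail) fun y IH => g (y ::ᵥ IH ::ᵥ v.tail) : ℕ) := by
  intro m ins out hins hout hne
  have hins' := fun i => hins (Fin.succ i)
  obtain ⟨p, hp⟩ := hf (m + 6) (fun i => ins i.succ) m (fun i => by have := hins' i; omega)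
    (by omega) (fun i => (hins' i).ne)
  obtain ⟨q, hq⟩ := hg (m + 6) (Fin.cons (m + 1) (Fin.cons m fun i => ins i.succ)) (m + 2)
    (by
      refine Fin.cases (by simp) (Fin.cases (by simp) fun i => ?_)
      have := hins' i
      simp; omega)
    (by omega)
    (by
      refine Fin.cases (by simp) (Fin.cases (by simp) fun i => ?_)
      have := hins' i
      simp; omega)
  have nd₁ : [ins 0, m + 3, m + 4, m + 5].Nodup := by have := hins 0; simp; omega
  have nd₂ : [m + 2, m, m + 4, m + 5].Nodup := by simp
  have nd₃ : [m, out, m + 4, m + 5].Nodup := by simp; omega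
  let body := seq (dec (m + 3)) (seq q (seq (copy (m + 2) m (m + 4) (m + 5)) (inc (m + 1))))
  refine ⟨seq p (seq (clear (m + 1)) (seq (copy (ins 0) (m + 3) (m + 4) (m + 5))
    (seq (star body) (seq (isZero (m + 3)) (copy m out (m + 4) (m + 5)))))), fun s => ?_⟩
  let tl := List.Vector.ofFn fun i => s (ins i.succ)
  let F : ℕ → ℕ := fun k => k.rec (f tl) fun y IH => g (y ::ᵥ IH ::ᵥ tl)
  let I : (ℕ → ℕ) → Prop := fun s' =>
    s' (m + 1) + s' (m + 3) = s (ins 0) ∧ s' m = F (s' (m + 1)) ∧ ∀ r < m, s' r = s r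
  have htl : ∀ s' : ℕ → ℕ, (∀ r < m, s' r = s r) →
      (List.Vector.ofFn fun i => s' (ins i.succ)) = tl := fun s' h => by
    simp only [h _ (hins' _), tl]
  have hbody : ∀ s₁ s₂, I s₁ → body.Rel s₁ s₂ → I s₂ ∧ s₂ (m + 3) < s₁ (m + 3) := by
    rintro s₁ s₂ ⟨hN, hacc, hfr⟩ h
    simp only [body, rel_seq, rel_dec, rel_inc] at h
    obtain ⟨s₃, ⟨h0, h₃⟩, s₄, h₄, s₅, h₅, rfl⟩ := h
    have e₃ : ∀ r, r ≠ m + 3 → s₃ r = s₁ r := fun r hr => by simp [h₃, hr]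
    have e₃' : s₃ (m + 3) = s₁ (m + 3) - 1 := by simp [h₃]
    obtain ⟨e₄, o₄⟩ := (hq s₃).1 _ h₄
    obtain ⟨o₅, e₅⟩ := copy_spec nd₂ h₅
    have o₄' : s₄ (m + 2) = g (s₃ (m + 1) ::ᵥ s₃ m ::ᵥ
      List.Vector.ofFn fun i => s₃ (ins i.succ)) := Part.mem_some_iff.1 o₄
    rw [htl s₃ fun r hr => (e₃ r (by omega)).trans (hfr r hr), e₃ _ (by omega),
      e₃ _ (by omega), hacc] at o₄'
    have c₁ : s₅ (m + 1) = s₁ (m + 1) := by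
      rw [e₅ _ (by omega) (by omega) (by omega), e₄ _ (by omega) (by omega), e₃ _ (by omega)]
    have c₂ : s₅ (m + 3) = s₁ (m + 3) - 1 := by
      rw [e₅ _ (by omega) (by omega) (by omega), e₄ _ (by omega) (by omega), e₃']
    refine ⟨⟨?_, ?_, fun r hr => ?_⟩, ?_⟩
    · simp [c₁, c₂]; omega
    · simp [c₁, o₅, o₄', F]
    · rw [update_of_ne (by omega), e₅ _ (by omega) (by omega) (by omega),
        e₄ _ (by omega) (by omega), e₃ _ (by omega), hfr r hr]
    · simp [c₂]; omega
  have hbase : ∀ s₁ s₂ s₃, p.Rel s s₁ → (clear (m + 1)).Rel s₁ s₂ →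
      (copy (ins 0) (m + 3) (m + 4) (m + 5)).Rel s₂ s₃ → I s₃ := by
    intro s₁ s₂ s₃ h₁ h₂ h₃
    obtain ⟨e₁, o₁⟩ := (hp s).1 _ h₁
    have h₂ := rel_clear.1 h₂
    have e₂ : ∀ r, r ≠ m + 1 → s₂ r = s₁ r := fun r hr => by simp [h₂, hr]
    have o₂ : s₂ (m + 1) = 0 := by simp [h₂]
    obtain ⟨o₃, e₃⟩ := copy_spec nd₁ h₃
    have o₁' : s₁ m = f tl := Part.mem_some_iff.1 o₁
    have hfr : ∀ r < m, s₂ r = s r := fun r hr => by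
      rw [e₂ _ (by omega), e₁ _ (by omega) (by omega)]
    refine ⟨?_, ?_, fun r hr => ?_⟩
    · rw [e₃ _ (by omega) (by omega) (by omega), o₂, o₃, hfr _ (hins 0), zero_add]
    · rw [e₃ _ (by omega) (by omega) (by omega), e₃ _ (by omega) (by omega) (by omega), o₂,
        e₂ _ (by omega), o₁']
      rfl
    · rw [e₃ _ (by omega) (by omega) (by omega), hfr r hr]
  refine ⟨fun s' h => ?_, fun _ => ?_⟩
  · simp only [rel_seq, rel_isZero] at h
    obtain ⟨s₁, h₁, s₂, h₂, s₃, h₃, s₄, h₄, _, ⟨h0, rfl⟩, h₅⟩ := h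
    obtain ⟨hN, hacc, hfr⟩ := rel_star_invariant (fun a b ha hab => (hbody a b ha hab).1)
      (hbase _ _ _ h₁ h₂ h₃) h₄
    obtain ⟨o₅, e₅⟩ := copy_spec nd₃ h₅
    refine ⟨fun r hr hro => ?_, Part.mem_some_iff.2 ?_⟩
    · rw [e₅ _ hro (by omega) (by omega), hfr r hr]
    · rw [h0, add_zero] at hN
      rw [o₅, hacc, hN]
      rfl
  · obtain ⟨s₁, h₁⟩ := (hp s).2 trivial
    have h₂ := rel_clear.2 (rfl : update s₁ (m + 1) 0 = _)
    have h₃ := (rel_copy nd₁ (s := update s₁ (m + 1) 0)).2 rfl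
    obtain ⟨s₄, h₄, -, h0⟩ := exists_rel_star (p := body) (fun s => s (m + 3))
      (fun s₁ h₁ h0 => by
        obtain ⟨s₂, h₂⟩ := (hq (update s₁ (m + 3) (s₁ (m + 3) - 1))).2 trivial
        have h : body.Rel s₁ _ := rel_seq.2 ⟨_, rel_dec.2 ⟨h0, rfl⟩, rel_seq.2 ⟨_, h₂,
          rel_seq.2 ⟨_, (rel_copy nd₂).2 rfl, rel_inc.2 rfl⟩⟩⟩
        exact ⟨_, h, hbody _ _ h₁ h⟩) (hbase _ _ _ h₁ h₂ h₃)
    exact ⟨_, rel_seq.2 ⟨_, h₁, rel_seq.2 ⟨_, h₂, rel_seq.2 ⟨_, h₃, rel_seq.2 ⟨_, h₄,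
      rel_seq.2 ⟨_, rel_isZero.2 ⟨h0, rfl⟩, (rel_copy nd₃).2 rfl⟩⟩⟩⟩⟩⟩

theorem Computable.rfind {n : ℕ} {f : List.Vector ℕ (n + 1) → ℕ}
    (hf : Computable fun v => Part.some (f v)) :
    Computable fun v : List.Vector ℕ n =>
      Nat.rfind fun k => Part.some (decide (f (k ::ᵥ v) = 0)) := by
  intro m ins out hins hout hne
  obtain ⟨p, hp⟩ := hf (m + 4) (Fin.cons m ins) (m + 1)
    (by
      refine Fin.cases (by simp) fun i => ?_
      have := hins i
      simp; omega)
    (by omega)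
    (by
      refine Fin.cases (by simp) fun i => ?_
      have := hins i
      simp; omega)
  have nd : [m, out, m + 2, m + 3].Nodup := by simp; omega
  let body := seq p (seq (dec (m + 1)) (inc m))
  refine ⟨seq (clear m) (seq (star body) (seq p (seq (isZero (m + 1))
    (copy m out (m + 2) (m + 3))))), fun s => ?_⟩
  let v := List.Vector.ofFn (s ∘ ins)
  have hv : ∀ s' : ℕ → ℕ, (∀ r < m, s' r = s r) → List.Vector.ofFn (s' ∘ ins) = v := fun s' h => by
    simp only [Function.comp_def, h _ (hins _), v]
  have hp' : ∀ s₁ s₂, (∀ r < m, s₁ r = s r) → p.Rel s₁ s₂ →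
      s₂ (m + 1) = f (s₁ m ::ᵥ v) ∧ s₂ m = s₁ m ∧ ∀ r < m, s₂ r = s r := by
    intro s₁ s₂ h₁ h
    obtain ⟨e, o⟩ := (hp s₁).1 _ h
    have o : s₂ (m + 1) = f (s₁ m ::ᵥ List.Vector.ofFn (s₁ ∘ ins)) := Part.mem_some_iff.1 o
    rw [hv s₁ h₁] at o
    exact ⟨o, e _ (by omega) (by omega), fun r hr => by
      rw [e _ (by omega) (by omega), h₁ r hr]⟩
  let I : (ℕ → ℕ) → Prop := fun s' => (∀ k < s' m, f (k ::ᵥ v) ≠ 0) ∧ ∀ r < m, s' r = s r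
  have hbody : ∀ s₁ s₂, I s₁ → body.Rel s₁ s₂ → I s₂ ∧ s₂ m = s₁ m + 1 := by
    rintro s₁ s₂ ⟨hne, hfr⟩ h
    simp only [body, rel_seq, rel_dec, rel_inc] at h
    obtain ⟨s₃, h₃, _, ⟨h0, rfl⟩, rfl⟩ := h
    obtain ⟨o, hm, hfr₃⟩ := hp' _ _ hfr h₃
    refine ⟨⟨fun k hk => ?_, fun r hr => ?_⟩, by simp [hm]⟩
    · simp only [update_self, ne_eq, Nat.left_eq_add, one_ne_zero, not_false_eq_true,
        update_of_ne, hm] at hk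
      rcases Nat.lt_succ_iff_lt_or_eq.1 hk with hk | rfl
      · exact hne k hk
      · exact o ▸ h0
    · rw [update_of_ne (by omega), update_of_ne (by omega), hfr₃ r hr]
  have hbase : I (update s m 0) := ⟨by simp, fun r hr => by simp [hr.ne]⟩
  refine ⟨fun s' h => ?_, fun hd => ?_⟩
  · simp only [rel_seq, rel_isZero, rel_clear] at h
    obtain ⟨_, rfl, s₁, h₁, s₂, h₂, _, ⟨h0, rfl⟩, h₃⟩ := h
    obtain ⟨hne, hfr⟩ := rel_star_invariant (fun a b ha hab => (hbody a b ha hab).1) hbase h₁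
    obtain ⟨o, hm, hfr₂⟩ := hp' _ _ hfr h₂
    obtain ⟨o₃, e₃⟩ := copy_spec nd h₃
    refine ⟨fun r hr hro => ?_, ?_⟩
    · rw [e₃ _ hro (by omega) (by omega), hfr₂ r hr]
    · refine Nat.mem_rfind.2 ?_
      rw [o₃, hm]
      refine ⟨?_, fun {k} hk => ?_⟩
      · simpa using (o.symm.trans h0).symm ▸ rfl
      · simpa using hne k hk
  · obtain ⟨N, hN⟩ := Part.dom_iff_mem.1 hd
    obtain ⟨hN0, hNlt⟩ := Nat.mem_rfind.1 hN
    have hN0 : f (N ::ᵥ v) = 0 := by simpa using hN0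
    have hNlt : ∀ k < N, f (k ::ᵥ v) ≠ 0 := fun k hk => by simpa using hNlt hk
    obtain ⟨s₁, h₁, ⟨⟨hne, hfr⟩, hle⟩, h0⟩ := exists_rel_star (p := body)
      (I := fun s => I s ∧ s m ≤ N) (fun s => N - s m)
      (fun s₁ h₁ h0 => by
        obtain ⟨s₂, h₂⟩ := (hp s₁).2 trivial
        have h : body.Rel s₁ _ := rel_seq.2 ⟨_, h₂, rel_seq.2 ⟨_, rel_dec.2 ⟨by
          rw [(hp' _ _ h₁.1.2 h₂).1]
          exact hNlt _ (by omega), rfl⟩, rel_inc.2 rfl⟩⟩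
        obtain ⟨hI, hs⟩ := hbody _ _ h₁.1 h
        exact ⟨_, h, ⟨hI, by omega⟩, by omega⟩) ⟨hbase, by simp⟩
    obtain ⟨s₂, h₂⟩ := (hp s₁).2 trivial
    refine ⟨_, rel_seq.2 ⟨_, rel_clear.2 rfl, rel_seq.2 ⟨_, h₁, rel_seq.2 ⟨_, h₂,
      rel_seq.2 ⟨_, rel_isZero.2 ⟨?_, rfl⟩, (rel_copy nd).2 rfl⟩⟩⟩⟩⟩
    rw [(hp' _ _ hfr h₂).1, show s₁ m = N by omega, hN0]

theorem computable_of_primrec' {n : ℕ} {f : List.Vector ℕ n → ℕ} (hf : Nat.Primrec' f) :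
    Computable fun v => Part.some (f v) := by
  induction hf with
  | zero => exact computable_zero
  | succ => exact computable_succ
  | get i => exact computable_get i
  | comp g _ _ hf hg =>
    refine hf.comp hg fun v y => ?_
    constructor
    · exact fun h => ⟨_, fun _ => Part.mem_some _, h⟩
    · rintro ⟨w, hw, hy⟩
      obtain rfl : w = fun i => g i v := funext fun i => Part.mem_some_iff.1 (hw i)
      exact hy
  | prec _ _ hf hg => exact hf.prec hg

theorem mem_mOfFn {α : Type*} {n : ℕ} {g : Fin n → Part α} {v : List.Vector α n} :
    v ∈ List.Vector.mOfFn g ↔ ∃ w : Fin n → α, (∀ i, w i ∈ g i) ∧ v = List.Vector.ofFn w := by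
  induction n with
  | zero => simp [List.Vector.mOfFn, List.Vector.ofFn, Part.pure_eq_some]
  | succ n ih =>
    simp only [List.Vector.mOfFn, Part.bind_eq_bind, Part.mem_bind_iff, Part.pure_eq_some,
      Part.mem_some_iff, ih]
    constructor
    · rintro ⟨a, ha, _, ⟨w, hw, rfl⟩, rfl⟩
      exact ⟨Fin.cons a w, Fin.cases ha hw, rfl⟩
    · rintro ⟨w, hw, rfl⟩
      exact ⟨w 0, hw 0, _, ⟨fun i => w i.succ, fun i => hw _, rfl⟩, rfl⟩

theorem computable_of_partrec' {n : ℕ} {f : List.Vector ℕ n →. ℕ} (hf : Nat.Partrec' f) :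
    Computable f := by
  induction hf with
  | prim hf => exact computable_of_primrec' hf
  | comp g _ _ hf hg =>
    refine hf.comp hg fun v y => ?_
    refine Part.mem_bind_iff.trans ?_
    simp only [mem_mOfFn]
    constructor
    · rintro ⟨_, ⟨w, hw, rfl⟩, hy⟩
      exact ⟨w, hw, hy⟩
    · rintro ⟨w, hw, hy⟩
      exact ⟨_, ⟨w, hw, rfl⟩, hy⟩
  | rfind _ hf => exact hf.rfind

/-- The domain of every partial recursive function is the set of inputs, given in counter `0`, on
which some counter program has a complete run. -/
theorem exists_rel_iff_dom {f : ℕ →. ℕ} (hf : Partrec f) :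
    ∃ p : CounterProgram, ∀ n, (∃ s', p.Rel (update 0 0 n) s') ↔ (f n).Dom := by
  obtain ⟨p, hp⟩ := computable_of_partrec' (Nat.Partrec'.part_iff₁.2 hf) 2 (fun _ => 0) 1
    (by simp) (by simp) (by simp)
  refine ⟨p, fun n => ⟨?_, (hp (update 0 0 n)).2⟩⟩
  rintro ⟨s', h⟩
  exact Part.dom_iff_mem.2 ⟨_, ((hp _).1 _ h).2⟩

end CounterProgram

namespace CounterAction

/-- The index of the counter an action refers to. -/
def counter : CounterAction → ℕ
  | move _ k => k
  | test k => k

/-- An injective numbering of the actions. -/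
def code : CounterAction → ℕ
  | move true k => 3 * k
  | move false k => 3 * k + 1
  | test k => 3 * k + 2

theorem code_injective : Function.Injective code := by
  rintro (⟨_ | _, k⟩ | k) (⟨_ | _, l⟩ | l) h <;> simp [code] at h ⊢ <;> omega

/-- The binary encoding of an action. -/
def encode (a : CounterAction) : List (Fin 2) := List.replicate a.code 1 ++ [0]

/-- The binary encoding of a sequence of actions. -/
def encodeTrace (t : List CounterAction) : List (Fin 2) := t.flatMap encode

@[simp]
theorem encodeTrace_nil : encodeTrace [] = [] := rfl

@[simp]
theorem encodeTrace_cons (a : CounterAction) (t : List CounterAction) :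
    encodeTrace (a :: t) = a.encode ++ encodeTrace t := rfl

@[simp]
theorem encodeTrace_append (t u : List CounterAction) :
    encodeTrace (t ++ u) = encodeTrace t ++ encodeTrace u := List.flatMap_append

theorem encode_append_inj {a b : CounterAction} {x y : List (Fin 2)}
    (h : a.encode ++ x = b.encode ++ y) : a = b ∧ x = y := by
  have key : ∀ i j : ℕ, List.replicate i (1 : Fin 2) ++ 0 :: x = List.replicate j 1 ++ 0 :: y →
      i = j ∧ x = y := by
    intro i
    induction i with
    | zero => rintro (_ | j) h <;> simp_all [List.replicate_succ]
    | succ i ih => rintro (_ | j) h <;> simp_all [List.replicate_succ]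
  obtain ⟨hc, hxy⟩ := key a.code b.code (by simpa [encode] using h)
  exact ⟨code_injective hc, hxy⟩

theorem exists_eq_append_of_encodeTrace_eq {t u : List CounterAction} {v : List (Fin 2)}
    (h : encodeTrace t = encodeTrace u ++ v) : ∃ t', t = u ++ t' := by
  induction u generalizing t with
  | nil => exact ⟨t, rfl⟩
  | cons a u ih =>
    cases t with
    | nil => simp [encode] at h
    | cons b t =>
      rw [encodeTrace_cons, encodeTrace_cons, List.append_assoc] at h
      obtain ⟨rfl, htu⟩ := encode_append_inj h
      obtain ⟨rest, rfl⟩ := ih htu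
      exact ⟨rest, rfl⟩

/-- The sign `1` or `-1` of a direction. -/
def sign (b : Bool) : ℤ := if b then 1 else -1

/-- The amount an action adds to counter `k`. -/
def delta (k : ℕ) : CounterAction → ℤ
  | move b l => if l = k then sign b else 0
  | test _ => 0

/-- The total amount a sequence of actions adds to counter `k`. -/
def weight (k : ℕ) (t : List CounterAction) : ℤ := (t.map (delta k)).sum

@[simp]
theorem weight_nil (k : ℕ) : weight k [] = 0 := rfl

@[simp]
theorem weight_cons (k : ℕ) (a : CounterAction) (t : List CounterAction) :
    weight k (a :: t) = delta k a + weight k t := List.sum_cons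

@[simp]
theorem weight_append (k : ℕ) (t u : List CounterAction) :
    weight k (t ++ u) = weight k t + weight k u := by simp [weight]

theorem Step.apply_eq {a : CounterAction} {s s' : ℕ → ℕ} (h : a.Step s s') (k : ℕ) :
    (s' k : ℤ) = s k + delta k a := by
  rcases a with ⟨_ | _, l⟩ | l
  · obtain ⟨h0, rfl⟩ := h
    rcases eq_or_ne l k with rfl | hk
    · simp [delta, sign]; omega
    · simp [delta, hk, hk.symm]
  · obtain rfl := h
    rcases eq_or_ne l k with rfl | hk
    · simp [delta, sign]
    · simp [delta, hk, hk.symm]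
  · obtain ⟨h0, rfl⟩ := h
    simp [delta]

theorem Run.apply_eq {t : List CounterAction} {s s' : ℕ → ℕ} (h : Run t s s') (k : ℕ) :
    (s' k : ℤ) = s k + weight k t := by
  induction t generalizing s with
  | nil =>
    obtain rfl := h
    simp
  | cons a t ih =>
    obtain ⟨s₁, h₁, h₂⟩ := h
    rw [ih h₂, h₁.apply_eq, weight_cons, add_assoc]

/-- After the actions `u`, started from zero counters, the action `a` is impossible. -/
def Blocked (u : List CounterAction) : CounterAction → Prop
  | move true _ => False
  | move false k => weight k u ≤ 0
  | test k => weight k u ≠ 0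

theorem exists_step_iff {u : List CounterAction} {s : ℕ → ℕ} (h : Run u 0 s)
    (a : CounterAction) : (∃ s', a.Step s s') ↔ ¬ Blocked u a := by
  have hw := h.apply_eq
  rcases a with ⟨_ | _, l⟩ | l
  · have := hw l
    simp only [Step, Blocked, Pi.zero_apply] at this ⊢
    simp
    omega
  · simp [Step, Blocked]
  · have := hw l
    simp only [Step, Blocked, Pi.zero_apply] at this ⊢
    simp
    omega

theorem not_blocked_of_run {u v : List CounterAction} {a : CounterAction} {s : ℕ → ℕ}
    (h : Run (u ++ a :: v) 0 s) : ¬ Blocked u a := by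
  obtain ⟨s₁, h₁, s₂, h₂, -⟩ := run_append.1 h
  exact (exists_step_iff h₁ a).1 ⟨s₂, h₂⟩

theorem exists_run_or_blocked (t : List CounterAction) :
    (∃ s, Run t 0 s) ∨ ∃ u a v, t = u ++ a :: v ∧ Blocked u a := by
  induction t using List.reverseRecOn with
  | nil => exact Or.inl ⟨0, rfl⟩
  | append_singleton t a ih =>
    rcases ih with ⟨s, hs⟩ | ⟨u, b, v, rfl, hb⟩
    · by_cases hb : Blocked t a
      · exact Or.inr ⟨t, a, [], rfl, hb⟩
      · obtain ⟨s', hs'⟩ := (exists_step_iff hs a).2 hb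
        exact Or.inl ⟨s', run_append.2 ⟨s, hs, s', hs', rfl⟩⟩
    · exact Or.inr ⟨u, b, v ++ [a], by simp, hb⟩

theorem exists_eq_append_move {b : Bool} {k : ℕ} {t : List CounterAction}
    (h : 0 < sign b * weight k t) : ∃ u v, t = u ++ move b k :: v ∧ weight k u = 0 := by
  have key : ∀ c ≤ 0, 0 < c + sign b * weight k t →
      ∃ u v, t = u ++ move b k :: v ∧ c + sign b * weight k u = 0 := by
    clear h
    induction t with
    | nil => intro c hc h; simp at h; omega
    | cons a t ih =>
      intro c hc h
      rw [weight_cons, mul_add, ← add_assoc] at h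
      by_cases hle : c + sign b * delta k a ≤ 0
      · obtain ⟨u, v, rfl, hu⟩ := ih _ hle h
        exact ⟨a :: u, v, rfl, by rw [weight_cons, mul_add, ← add_assoc, hu]⟩
      · refine ⟨[], t, ?_, ?_⟩
        · rcases a with ⟨b', l⟩ | l
          · rcases eq_or_ne l k with rfl | hl
            · cases b <;> cases b' <;> simp [delta, sign] at hle ⊢ <;> omega
            · simp [delta, hl] at hle; omega
          · simp [delta] at hle; omega
        · rcases a with ⟨b', l⟩ | l
          · by_cases hl : l = k <;> cases b <;> cases b' <;>
              simp [delta, sign, hl] at hle ⊢ <;> omega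
          · simp [delta] at hle; omega
  obtain ⟨u, v, rfl, hu⟩ := key 0 le_rfl (by simpa using h)
  refine ⟨u, v, rfl, ?_⟩
  cases b <;> simpa [sign] using hu

end CounterAction

namespace CounterProgram

open CounterAction Computability

/-- The binary encodings of the traces of a program. -/
def encodedTraces (p : CounterProgram) : Language (Fin 2) := encodeTrace '' p.traces

theorem isRegular_encodedTraces (p : CounterProgram) : p.encodedTraces.IsRegular := by
  induction p with
  | act a =>
    have : (act a).encodedTraces = ({a.encode} : Language (Fin 2)) := by
      change encodeTrace '' {[a]} = {a.encode}
      simp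
    exact this ▸ .singleton _
  | seq p q hp hq =>
    have : (seq p q).encodedTraces = p.encodedTraces * q.encodedTraces :=
      Set.image_image2_distrib encodeTrace_append
    exact this ▸ hp.mul hq
  | star p hp =>
    have : (star p).encodedTraces = p.encodedTraces∗ := by
      ext w
      constructor
      · rintro ⟨_, ⟨S, rfl, hS⟩, rfl⟩
        refine ⟨S.map encodeTrace, ?_, ?_⟩
        · induction S <;> simp_all
        · simp only [List.mem_map]
          rintro _ ⟨t, ht, rfl⟩
          exact ⟨t, hS t ht, rfl⟩
      · rintro ⟨S, rfl, hS⟩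
        induction S with
        | nil => exact ⟨[], Language.nil_mem_kstar _, rfl⟩
        | cons x S ih =>
          obtain ⟨_, ⟨S', rfl, hS'⟩, ht'⟩ := ih fun y hy => hS y (List.mem_cons_of_mem _ hy)
          obtain ⟨t, ht, rfl⟩ := hS x List.mem_cons_self
          refine ⟨_, ⟨t :: S', rfl, by simpa using ⟨ht, hS'⟩⟩, ?_⟩
          simp [ht']
    exact this ▸ hp.kstar

/-- All counters of a program lie below a common bound. -/
theorem exists_counter_lt (p : CounterProgram) :
    ∃ K, ∀ t ∈ p.traces, ∀ a ∈ t, a.counter < K := by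
  induction p with
  | act a => exact ⟨a.counter + 1, by rintro _ rfl; simp⟩
  | seq p q hp hq =>
    obtain ⟨K, hK⟩ := hp
    obtain ⟨K', hK'⟩ := hq
    refine ⟨max K K', ?_⟩
    rintro _ ⟨t, ht, u, hu, rfl⟩ a ha
    rcases List.mem_append.1 ha with ha | ha
    · exact lt_max_of_lt_left (hK t ht a ha)
    · exact lt_max_of_lt_right (hK' u hu a ha)
  | star p hp =>
    obtain ⟨K, hK⟩ := hp
    refine ⟨K, ?_⟩
    rintro _ ⟨S, rfl, hS⟩ a ha
    obtain ⟨t, ht, ha⟩ := List.mem_flatten.1 ha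
    exact hK t (hS t ht) a ha

end CounterProgram

/-- Nonterminals of a grammar for the words that do not encode a complete run of a counter
program; `σ` is the set of states of an automaton rejecting exactly the encoded traces. -/
inductive TraceSymbol (σ : Type)
  | start
  | any
  | opt
  | action (a : CounterAction)
  | state (q : σ)
  | zero (k : ℕ)
  | side (b : Bool) (k : ℕ)

namespace TraceSymbol

open CounterAction Sum

variable {σ : Type}

/-- A numbering of the nonterminals extending a numbering of the automaton states. -/
def code (e : σ → ℕ) : TraceSymbol σ → ℕ
  | start => Nat.pair 0 0
  | any => Nat.pair 1 0
  | opt => Nat.pair 2 0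
  | action a => Nat.pair 3 a.code
  | state q => Nat.pair 4 (e q)
  | zero k => Nat.pair 5 k
  | side false k => Nat.pair 6 k
  | side true k => Nat.pair 7 k

theorem code_injective {e : σ → ℕ} (he : Function.Injective e) :
    Function.Injective (code e) := by
  rintro (_ | _ | _ | a | q | k | ⟨_ | _, k⟩) (_ | _ | _ | a' | q' | k' | ⟨_ | _, k'⟩) h <;>
    simp only [code, Nat.pair_eq_pair, CounterAction.code_injective.eq_iff, he.eq_iff] at h <;>
    simp_all

/-- The input-independent rules: `zero k` generates the traces of total weight zero at counter `k`,
`side b k` those of positive or negative weight, and `start` the words that are not encoded traces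
or perform an impossible action. -/
inductive IsRule (M : DFA (Fin 2) σ) (K : ℕ) : TraceSymbol σ × List (TraceSymbol σ ⊕ Fin 2) → Prop
  | any_nil : IsRule M K (any, [])
  | any_cons (a : Fin 2) : IsRule M K (any, [inr a, inl any])
  | opt_nil : IsRule M K (opt, [])
  | opt_inc : IsRule M K (opt, [inl (action (move true 0))])
  | action (a : CounterAction) (ha : a.counter < K) : IsRule M K (action a, a.encode.map inr)
  | state_nil (q : σ) (hq : q ∈ M.accept) : IsRule M K (state q, [])
  | state_cons (q : σ) (a : Fin 2) : IsRule M K (state q, [inr a, inl (state (M.step q a))])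
  | zero_nil (k : ℕ) (hk : k < K) : IsRule M K (zero k, [])
  | zero_neutral (k : ℕ) (hk : k < K) (a : CounterAction) (ha : a.counter < K)
      (h : delta k a = 0) : IsRule M K (zero k, [inl (action a), inl (zero k)])
  | zero_move (k : ℕ) (hk : k < K) (b : Bool) : IsRule M K (zero k,
      [inl (action (move b k)), inl (zero k), inl (action (move (!b) k)), inl (zero k)])
  | side_zero (k : ℕ) (hk : k < K) (b : Bool) : IsRule M K (side b k,
      [inl (zero k), inl (action (move b k)), inl (zero k)])
  | side_side (k : ℕ) (hk : k < K) (b : Bool) : IsRule M K (side b k,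
      [inl (zero k), inl (action (move b k)), inl (side b k)])
  | start_state : IsRule M K (start, [inl (state M.start)])
  | start_zero_dec (k : ℕ) (hk : k < K) : IsRule M K (start,
      [inl (zero k), inl (action (move false k)), inl any])
  | start_neg_dec (k : ℕ) (hk : k < K) : IsRule M K (start,
      [inl (side false k), inl (action (move false k)), inl any])
  | start_side_test (k : ℕ) (hk : k < K) (b : Bool) : IsRule M K (start,
      [inl (side b k), inl (action (test k)), inl any])

theorem finite_counter_lt (K : ℕ) : {a : CounterAction | a.counter < K}.Finite := by
  refine ((Set.finite_Iio K).image (move true) |>.union <|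
    (Set.finite_Iio K).image (move false) |>.union <| (Set.finite_Iio K).image test).subset ?_
  rintro (⟨_ | _, k⟩ | k) (h : k < K) <;> simp [h]

theorem finite_isRule [Finite σ] (M : DFA (Fin 2) σ) (K : ℕ) : {r | IsRule M K r}.Finite := by
  have hk := Set.finite_Iio K
  have ha := finite_counter_lt K
  have hkb := hk.prod (Set.finite_univ (α := Bool))
  refine (Set.Finite.union (Set.toFinite {(any, []), (opt, []),
      (opt, [inl (.action (move true 0))]), (start, [inl (state M.start)])}) <|
    (Set.finite_range fun a : Fin 2 => (any, [inr a, inl any])).union <|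
    (ha.image fun a => (.action a, a.encode.map inr)).union <|
    (Set.finite_range fun q : σ => (state q, [])).union <|
    (Set.finite_range fun x : σ × Fin 2 =>
      (state x.1, [inr x.2, inl (state (M.step x.1 x.2))])).union <|
    (hk.image fun k => (zero k, [])).union <|
    ((hk.prod ha).image fun x => (zero x.1, [inl (.action x.2), inl (zero x.1)])).union <|
    (hkb.image fun x => (zero x.1, [inl (.action (move x.2 x.1)), inl (zero x.1),
      inl (.action (move (!x.2) x.1)), inl (zero x.1)])).union <|
    (hkb.image fun x => (side x.2 x.1,
      [inl (zero x.1), inl (.action (move x.2 x.1)), inl (zero x.1)])).union <|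
    (hkb.image fun x => (side x.2 x.1,
      [inl (zero x.1), inl (.action (move x.2 x.1)), inl (side x.2 x.1)])).union <|
    (hk.image fun k => (start, [inl (zero k), inl (.action (move false k)), inl any])).union <|
    (hk.image fun k => (start, [inl (side false k), inl (.action (move false k)), inl any])).union <|
    (hkb.image fun x => (start, [inl (side x.2 x.1), inl (.action (test x.1)), inl any]))).subset ?_
  rintro _ (_ | _) <;> simp [*]

/-- The rules generating the words that do not start with exactly `n + 1` increments of counter
`0` followed by a decrement. -/
def inputRules (n : ℕ) : List (TraceSymbol σ × List (TraceSymbol σ ⊕ Fin 2)) :=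
  [(start, List.replicate n (inl opt) ++ [inl (action (move false 0)), inl any]),
    (start, List.replicate (n + 2) (inl (action (move true 0))) ++ [inl any])]

/-- `J` is closed under a grammar rule. -/
def Closed {N : Type} (J : N → Language (Fin 2)) (r : N × List (N ⊕ Fin 2)) : Prop :=
  (r.2.map (Sum.elim J fun a => {[a]})).prod ≤ J r.1

theorem prod_map_singleton (w : List (Fin 2)) :
    (w.map fun a => ({[a]} : Language (Fin 2))).prod = {w} := by
  induction w with
  | nil => rfl
  | cons a w ih =>
    rw [List.map_cons, List.prod_cons, ih]
    exact Set.image2_singleton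

section Complete

variable {M : DFA (Fin 2) σ} {K : ℕ} {J : TraceSymbol σ → Language (Fin 2)}

theorem mem_any (hJ : ∀ r, IsRule M K r → Closed J r) (w : List (Fin 2)) : w ∈ J any := by
  induction w with
  | nil => exact hJ _ .any_nil rfl
  | cons a w ih => exact hJ _ (.any_cons a) ⟨[a], rfl, w, ⟨w, ih, [], rfl, by simp⟩, rfl⟩

theorem mem_action (hJ : ∀ r, IsRule M K r → Closed J r) {a : CounterAction}
    (ha : a.counter < K) : a.encode ∈ J (action a) := by
  refine hJ _ (.action a ha) ?_
  simp only [List.map_map, Function.comp_def, Sum.elim_inr, prod_map_singleton]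
  rfl

theorem mem_state (hJ : ∀ r, IsRule M K r → Closed J r) {q : σ} {w : List (Fin 2)}
    (h : w ∈ M.acceptsFrom q) : w ∈ J (state q) := by
  induction w generalizing q with
  | nil => exact hJ _ (.state_nil q h) rfl
  | cons a w ih =>
    exact hJ _ (.state_cons q a) ⟨[a], rfl, w, ⟨w, ih h, [], rfl, by simp⟩, rfl⟩

theorem mem_zero (hJ : ∀ r, IsRule M K r → Closed J r) {k : ℕ} (hk : k < K)
    {t : List CounterAction} (ht : ∀ a ∈ t, a.counter < K) (h : weight k t = 0) :
    encodeTrace t ∈ J (zero k) := by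
  induction hn : t.length using Nat.strong_induction_on generalizing t with
  | _ n ih =>
    subst hn
    cases t with
    | nil => exact hJ _ (.zero_nil k hk) rfl
    | cons a t =>
      rw [List.forall_mem_cons] at ht
      rw [weight_cons] at h
      by_cases ha : delta k a = 0
      · refine hJ _ (.zero_neutral k hk a ht.1 ha) ⟨_, mem_action hJ ht.1, _,
          ⟨encodeTrace t, ih _ (by simp) ht.2 (by omega) rfl, _, rfl, List.append_nil _⟩, rfl⟩
      · obtain ⟨b, rfl⟩ : ∃ b, a = move b k := by
          rcases a with ⟨b, l⟩ | l
          · exact ⟨b, by_contra fun hl => ha (by simp_all [delta])⟩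
          · exact absurd rfl ha
        obtain ⟨u, v, rfl, hu⟩ : ∃ u v, t = u ++ move (!b) k :: v ∧ weight k u = 0 := by
          apply exists_eq_append_move
          cases b <;> simp [delta, sign] at h ⊢ <;> omega
        have hv : weight k v = 0 := by
          cases b <;> simp [delta, sign, hu] at h ⊢ <;> omega
        simp only [List.mem_append, List.mem_cons] at ht
        refine hJ _ (.zero_move k hk b) ⟨_, mem_action hJ hk, _, ⟨encodeTrace u,
          ih _ ?_ (fun a ha => ht.2 a (Or.inl ha)) hu rfl, _, ⟨_, mem_action hJ hk, _,
            ⟨encodeTrace v, ih _ ?_ (fun a ha => ht.2 a (Or.inr (Or.inr ha))) hv rfl,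
              _, rfl, List.append_nil _⟩, rfl⟩, rfl⟩, ?_⟩
        · simp
        · simp; omega
        · simp

theorem mem_side (hJ : ∀ r, IsRule M K r → Closed J r) {k : ℕ} (hk : k < K) {b : Bool}
    {t : List CounterAction} (ht : ∀ a ∈ t, a.counter < K) (h : 0 < sign b * weight k t) :
    encodeTrace t ∈ J (side b k) := by
  induction hn : t.length using Nat.strong_induction_on generalizing t with
  | _ n ih =>
    subst hn
    obtain ⟨u, v, rfl, hu⟩ := exists_eq_append_move h
    simp only [List.mem_append, List.mem_cons] at ht
    have hu' := mem_zero hJ hk (fun a ha => ht a (Or.inl ha)) hu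
    have htv := fun a ha => ht a (Or.inr (Or.inr ha))
    have hv : 0 ≤ sign b * weight k v := by
      cases b <;> simp [delta, sign, hu] at h ⊢ <;> omega
    rcases hv.eq_or_lt with hv | hv
    · have hv : weight k v = 0 := by cases b <;> simpa [sign, eq_comm] using hv
      exact hJ _ (.side_zero k hk b) ⟨_, hu', _, ⟨_, mem_action hJ hk, _,
        ⟨_, mem_zero hJ hk htv hv, _, rfl, List.append_nil _⟩, rfl⟩, by simp⟩
    · exact hJ _ (.side_side k hk b) ⟨_, hu', _, ⟨_, mem_action hJ hk, _,
        ⟨_, ih _ (by simp; omega) htv hv rfl, _, rfl, List.append_nil _⟩, rfl⟩, by simp⟩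

theorem mem_start_of_blocked (hJ : ∀ r, IsRule M K r → Closed J r) {u v : List CounterAction}
    {a : CounterAction} (ht : ∀ b ∈ u ++ a :: v, b.counter < K) (h : Blocked u a) :
    encodeTrace (u ++ a :: v) ∈ J start := by
  simp only [List.mem_append, List.mem_cons] at ht
  have ha := ht a (Or.inr (Or.inl rfl))
  have hu := fun b hb => ht b (Or.inl hb)
  have finish : ∀ A, encodeTrace u ∈ J A → IsRule M K (start, [inl A, inl (action a), inl any]) →
      encodeTrace (u ++ a :: v) ∈ J start := fun A hA hr =>
    hJ _ hr ⟨_, hA, _, ⟨_, mem_action hJ ha, _,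
      ⟨_, mem_any hJ (encodeTrace v), _, rfl, List.append_nil _⟩, rfl⟩, by simp⟩
  rcases a with ⟨_ | _, k⟩ | k
  · rcases (show weight k u ≤ 0 from h).eq_or_lt with h | h
    · exact finish _ (mem_zero hJ ha hu h) (.start_zero_dec k ha)
    · exact finish _ (mem_side (k := k) hJ ha hu (by simpa [sign] using h)) (.start_neg_dec k ha)
  · exact h.elim
  · rcases (show weight k u ≠ 0 from h).lt_or_gt with h | h
    · exact finish _ (mem_side (k := k) hJ ha hu (b := false) (by simpa [sign] using h))
        (.start_side_test k ha _)
    · exact finish _ (mem_side (k := k) hJ ha hu (b := true) (by simpa [sign] using h))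
        (.start_side_test k ha _)

theorem mem_start_of_ne (hK : 0 < K) (hJ : ∀ r, IsRule M K r → Closed J r) {n : ℕ}
    (hn : ∀ r ∈ inputRules n, Closed J r) {j : ℕ} (hj : j ≠ n + 1) (t : List CounterAction) :
    encodeTrace (List.replicate j (move true 0) ++ move false 0 :: t) ∈ J start := by
  have hx : (move true 0).encode ∈ J (action (move true 0)) := mem_action hJ hK
  have hpow : ∀ {L : Language (Fin 2)}, (move true 0).encode ∈ L → ∀ i,
      encodeTrace (List.replicate i (move true 0)) ∈ L ^ i := by
    intro L hL i
    induction i with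
    | zero => exact rfl
    | succ i ih => exact pow_succ' L i ▸ ⟨_, hL, _, ih, rfl⟩
  rcases lt_or_gt_of_ne hj with hj | hj
  · have hnil : [] ∈ J opt := hJ _ .opt_nil rfl
    have hopt : (move true 0).encode ∈ J opt :=
      hJ _ .opt_inc ⟨_, hx, _, rfl, List.append_nil _⟩
    have hadd : ∀ i, encodeTrace (List.replicate j (move true 0)) ∈ J opt ^ (j + i) := by
      intro i
      induction i with
      | zero => exact hpow hopt j
      | succ i ih => exact pow_succ (J opt) (j + i) ▸ ⟨_, ih, _, hnil, List.append_nil _⟩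
    obtain ⟨i, rfl⟩ := Nat.exists_eq_add_of_le (Nat.lt_succ_iff.1 hj)
    refine hn (start, _) List.mem_cons_self ?_
    simp only [List.map_append, List.map_replicate, List.prod_append, List.prod_replicate,
      Sum.elim_inl]
    exact ⟨_, hadd i, _, ⟨_, mem_action hJ hK, _,
      ⟨_, mem_any hJ (encodeTrace t), _, rfl, List.append_nil _⟩, rfl⟩, by simp⟩
  · obtain ⟨i, rfl⟩ := Nat.exists_eq_add_of_le (Nat.succ_le_iff.2 hj)
    refine hn (start, _) (List.mem_cons_of_mem _ List.mem_cons_self) ?_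
    simp only [List.map_append, List.map_replicate, List.prod_append, List.prod_replicate,
      Sum.elim_inl]
    refine ⟨_, hpow hx (n + 2), _, ⟨_, mem_any hJ (encodeTrace
      (List.replicate i (move true 0) ++ move false 0 :: t)), _, rfl, List.append_nil _⟩, ?_⟩
    simp [List.replicate_add]

end Complete

/-- The interpretation of the nonterminals used to show that `w` is not generated. -/
def avoiding (M : DFA (Fin 2) σ) (w : List (Fin 2)) : TraceSymbol σ → Language (Fin 2)
  | start => {w}ᶜ
  | any => ⊤
  | opt => {[], (move true 0).encode}
  | action a => {a.encode}
  | state q => M.acceptsFrom q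
  | zero k => {x | ∃ u, encodeTrace u = x ∧ weight k u = 0}
  | side b k => {x | ∃ u, encodeTrace u = x ∧ 0 < sign b * weight k u}

theorem closed_avoiding {M : DFA (Fin 2) σ} {K : ℕ} {t : List CounterAction} {s : ℕ → ℕ}
    (ht : Run t 0 s) (hM : encodeTrace t ∉ M.accepts)
    {r : TraceSymbol σ × List (TraceSymbol σ ⊕ Fin 2)} (hr : IsRule M K r) :
    Closed (avoiding M (encodeTrace t)) r := by
  have block : ∀ u (a : CounterAction) x, Blocked u a →
      encodeTrace u ++ (a.encode ++ x) ≠ encodeTrace t := by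
    intro u a x hb h
    obtain ⟨v, rfl⟩ := exists_eq_append_of_encodeTrace_eq (t := t) (u := u ++ [a]) (v := x)
      (by simp [← h])
    exact not_blocked_of_run (u := u) (a := a) (v := v) (by simpa using ht) hb
  cases hr with
  | any_nil | any_cons => exact fun _ _ => trivial
  | opt_nil => rintro _ rfl; exact Or.inl rfl
  | opt_inc => rintro _ ⟨_, rfl, _, rfl, rfl⟩; exact Or.inr (List.append_nil _)
  | action a ha =>
    intro w hw
    simp only [List.map_map, Function.comp_def, Sum.elim_inr, prod_map_singleton] at hw
    exact hw
  | state_nil q hq => rintro _ rfl; exact hq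
  | state_cons q a =>
    rintro _ ⟨_, rfl, _, ⟨w, hw, _, rfl, rfl⟩, rfl⟩
    change a :: (w ++ []) ∈ M.acceptsFrom q
    rw [List.append_nil]
    exact hw
  | zero_nil k hk => rintro _ rfl; exact ⟨[], rfl, rfl⟩
  | zero_neutral k hk a ha h =>
    rintro _ ⟨_, rfl, _, ⟨_, ⟨u, rfl, hu⟩, _, rfl, rfl⟩, rfl⟩
    exact ⟨a :: u, by simp, by simp [h, hu]⟩
  | zero_move k hk b =>
    rintro _ ⟨_, rfl, _, ⟨_, ⟨u, rfl, hu⟩, _, ⟨_, rfl, _, ⟨_, ⟨v, rfl, hv⟩, _, rfl, rfl⟩, rfl⟩,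
      rfl⟩, rfl⟩
    refine ⟨move b k :: u ++ move (!b) k :: v, by simp, ?_⟩
    cases b <;> simp [hu, hv, delta, sign]
  | side_zero k hk b =>
    rintro _ ⟨_, ⟨u, rfl, hu⟩, _, ⟨_, rfl, _, ⟨_, ⟨v, rfl, hv⟩, _, rfl, rfl⟩, rfl⟩, rfl⟩
    refine ⟨u ++ move b k :: v, by simp, ?_⟩
    cases b <;> simp [hu, hv, delta, sign]
  | side_side k hk b =>
    rintro _ ⟨_, ⟨u, rfl, hu⟩, _, ⟨_, rfl, _, ⟨_, ⟨v, rfl, hv⟩, _, rfl, rfl⟩, rfl⟩, rfl⟩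
    refine ⟨u ++ move b k :: v, by simp, ?_⟩
    cases b <;> simp [hu, delta, sign] at hv ⊢ <;> omega
  | start_state =>
    rintro _ ⟨w, hw, _, rfl, rfl⟩ h
    have h : w ++ [] = encodeTrace t := h
    rw [List.append_nil] at h
    exact hM (h ▸ hw)
  | start_zero_dec k hk =>
    rintro _ ⟨_, ⟨u, rfl, hu⟩, _, ⟨_, rfl, x, -, rfl⟩, rfl⟩ h
    exact block u (move false k) x hu.le h
  | start_neg_dec k hk =>
    rintro _ ⟨_, ⟨u, rfl, hu⟩, _, ⟨_, rfl, x, -, rfl⟩, rfl⟩ h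
    refine block u (move false k) x ?_ h
    simp only [sign, Bool.false_eq_true, if_false] at hu
    change weight k u ≤ 0
    omega
  | start_side_test k hk b =>
    rintro _ ⟨_, ⟨u, rfl, hu⟩, _, ⟨_, rfl, x, -, rfl⟩, rfl⟩ h
    refine block u (test k) x (fun h0 : weight k u = 0 => ?_) h
    simp [h0] at hu

theorem replicate_append_inj {α : Type*} {x c : α} (hxc : c ≠ x) {i j : ℕ} {u v : List α}
    (h : List.replicate i x ++ c :: u = List.replicate j x ++ c :: v) : i = j := by
  induction i generalizing j with
  | zero => cases j <;> simp_all [List.replicate_succ]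
  | succ i ih =>
    cases j with
    | zero => simp [List.replicate_succ, hxc.symm] at h
    | succ j =>
      simp only [List.replicate_succ, List.cons_append, List.cons.injEq, true_and] at h
      rw [ih h]

theorem closed_avoiding_inputRules (M : DFA (Fin 2) σ) {n : ℕ} (t : List CounterAction)
    {r : TraceSymbol σ × List (TraceSymbol σ ⊕ Fin 2)} (hr : r ∈ inputRules n) :
    Closed (avoiding M (encodeTrace (List.replicate (n + 1) (move true 0) ++ move false 0 :: t)))
      r := by
  have hopt : ∀ i, ∀ w ∈ avoiding M (encodeTrace
      (List.replicate (n + 1) (move true 0) ++ move false 0 :: t)) opt ^ i,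
        ∃ j ≤ i, w = encodeTrace (List.replicate j (move true 0)) := by
    intro i
    induction i with
    | zero => rintro w rfl; exact ⟨0, le_rfl, rfl⟩
    | succ i ih =>
      intro w hw
      rw [pow_succ'] at hw
      obtain ⟨a, ha, b, hb, rfl⟩ := hw
      obtain ⟨j, hj, rfl⟩ := ih b hb
      rcases ha with rfl | rfl
      · exact ⟨j, by omega, rfl⟩
      · exact ⟨j + 1, by omega, rfl⟩
  have hinc : ∀ i, ∀ w ∈ ({(move true 0).encode} : Language (Fin 2)) ^ i,
      w = encodeTrace (List.replicate i (move true 0)) := by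
    intro i
    induction i with
    | zero => rintro w rfl; rfl
    | succ i ih =>
      intro w hw
      rw [pow_succ'] at hw
      obtain ⟨a, rfl, b, hb, rfl⟩ := hw
      rw [ih b hb]
      rfl
  simp only [inputRules, List.mem_cons, List.not_mem_nil, or_false] at hr
  rcases hr with rfl | rfl <;> intro w hw <;>
    simp only [List.map_append, List.map_replicate, List.prod_append, List.prod_replicate,
      Sum.elim_inl] at hw
  · obtain ⟨_, hw, _, ⟨_, rfl, x, -, rfl⟩, rfl⟩ := hw
    obtain ⟨j, hj, rfl⟩ := hopt n _ hw
    intro h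
    obtain ⟨v, hv⟩ := exists_eq_append_of_encodeTrace_eq (v := x)
      (u := List.replicate j (move true 0) ++ [move false 0])
      (t := List.replicate (n + 1) (move true 0) ++ move false 0 :: t)
      (by rw [← show _ = _ from h]; simp)
    rw [List.append_assoc] at hv
    have := replicate_append_inj (by simp) hv
    omega
  · obtain ⟨_, hw, x, -, rfl⟩ := hw
    obtain rfl := hinc _ _ hw
    intro h
    obtain ⟨v, hv⟩ := exists_eq_append_of_encodeTrace_eq (v := x)
      (u := List.replicate (n + 2) (move true 0))
      (t := List.replicate (n + 1) (move true 0) ++ move false 0 :: t)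
      (by rw [← show _ = _ from h])
    rw [show n + 2 = n + 1 + 1 from rfl, List.replicate_add (n + 1), List.append_assoc] at hv
    simpa using List.append_cancel_left hv

end TraceSymbol

/-- Renaming the nonterminals of a rule to numbers. -/
def encodeRule {N : Type} (enc : N → ℕ) (r : N × List (N ⊕ Fin 2)) : ℕ × List (ℕ ⊕ Fin 2) :=
  (enc r.1, r.2.map (Sum.map enc id))

/-- The language of a numbered grammar is the component at the start symbol of the least
interpretation of the nonterminals closed under the rules. -/
theorem exists_least_closed {N : Type} {enc : N → ℕ} (henc : Function.Injective enc) (S : N)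
    (rules : List (N × List (N ⊕ Fin 2))) :
    ∃ J : N → Language (Fin 2),
      J S = (toCFG (enc S, rules.map (encodeRule enc))).language ∧
      (∀ r ∈ rules, TraceSymbol.Closed J r) ∧
      ∀ I : N → Language (Fin 2), (∀ r ∈ rules, TraceSymbol.Closed I r) → ∀ A, J A ≤ I A := by
  let g := toCFG (enc S, rules.map (encodeRule enc))
  have hmem : ∀ r : ContextFreeRule (Fin 2) ℕ, r ∈ g.rules ↔ ∃ r' ∈ rules,
      (⟨enc r'.1, (r'.2.map (Sum.map enc id)).map
        (Sum.elim Symbol.nonterminal Symbol.terminal)⟩ : ContextFreeRule (Fin 2) ℕ) = r := by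
    intro r
    have h := @List.mem_toFinset _ (Classical.decEq (ContextFreeRule (Fin 2) ℕ))
      ((rules.map (encodeRule enc)).map fun r =>
        ⟨r.1, r.2.map (Sum.elim Symbol.nonterminal Symbol.terminal)⟩) r
    rw [List.map_map, List.mem_map, ← List.map_map] at h
    exact h
  have hsymbol : ∀ (I : ℕ → Language (Fin 2)) (u : List (N ⊕ Fin 2)),
      (((u.map (Sum.map enc id)).map (Sum.elim Symbol.nonterminal Symbol.terminal)).map
        (ContextFreeGrammar.symbolLanguage I)) =
      u.map (Sum.elim (fun A => I (enc A)) fun a => {[a]}) := by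
    intro I u
    rw [List.map_map, List.map_map]
    refine List.map_congr_left fun x _ => ?_
    rcases x with x | x <;> rfl
  refine ⟨fun A => g.languageFrom (enc A), rfl, fun r hr => ?_, fun I hI A => ?_⟩
  · have := g.prod_le_languageFrom ((hmem _).2 ⟨r, hr, rfl⟩)
    unfold TraceSymbol.Closed
    rw [← hsymbol g.languageFrom]
    exact this
  · let I' : ℕ → Language (Fin 2) := fun k => {w | ∀ A, enc A = k → w ∈ I A}
    have hI' : ∀ A, I' (enc A) = I A := by
      intro A
      ext w
      exact ⟨fun h => h A rfl, fun h B hB => henc hB ▸ h⟩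
    have hle := g.languageFrom_le (I := I') (fun r hr => ?_) (enc A)
    · exact hle.trans (hI' A).le
    · obtain ⟨r, hr', rfl⟩ := (hmem r).1 hr
      refine le_trans (le_of_eq ?_) ((hI r hr').trans (hI' r.1).ge)
      refine (congrArg List.prod (hsymbol I' r.2)).trans ?_
      simp only [hI']

namespace CounterProgram

open CounterAction Function TraceSymbol

theorem run_replicate_inc (j : ℕ) : Run (List.replicate j (move true 0)) 0 (update 0 0 j) := by
  induction j with
  | zero => exact (update_eq_self 0 (0 : ℕ → ℕ))
  | succ j ih =>
    rw [List.replicate_succ']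
    refine run_append.2 ⟨_, ih, _, rfl, ?_⟩
    simp [Run]

theorem run_unique {t : List CounterAction} {s s₁ s₂ : ℕ → ℕ} (h₁ : Run t s s₁)
    (h₂ : Run t s s₂) : s₁ = s₂ := by
  ext k
  have := h₁.apply_eq k
  have := h₂.apply_eq k
  omega

/-- Load the input `n` by `n + 1` increments followed by a decrement, then run the program. -/
def withInput (p : CounterProgram) : CounterProgram :=
  seq (star (inc 0)) (seq (dec 0) p)

theorem mem_traces_withInput {p : CounterProgram} {t : List CounterAction} :
    t ∈ p.withInput.traces ↔
      ∃ j, ∃ t' ∈ p.traces, t = List.replicate j (move true 0) ++ move false 0 :: t' := by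
  constructor
  · rintro ⟨_, ⟨S, rfl, hS⟩, _, ⟨_, rfl, t', ht', rfl⟩, rfl⟩
    refine ⟨S.length, t', ht', ?_⟩
    congr 1
    clear ht'
    induction S with
    | nil => rfl
    | cons x S ih =>
      obtain rfl : x = [move true 0] := hS x List.mem_cons_self
      rw [List.flatten_cons, ih fun y hy => hS y (List.mem_cons_of_mem _ hy)]
      rfl
  · rintro ⟨j, t', ht', rfl⟩
    refine ⟨_, ⟨List.replicate j [move true 0], ?_, fun y hy => List.eq_of_mem_replicate hy⟩,
      _, ⟨_, rfl, t', ht', rfl⟩, rfl⟩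
    simp

theorem run_input_iff {n : ℕ} {t : List CounterAction} {s : ℕ → ℕ} :
    Run (List.replicate (n + 1) (move true 0) ++ move false 0 :: t) 0 s ↔
      Run t (update 0 0 n) s := by
  constructor
  · intro h
    obtain ⟨s₁, h₁, _, ⟨-, rfl⟩, h⟩ := run_append.1 h
    obtain rfl := run_unique h₁ (run_replicate_inc _)
    simpa using h
  · intro h
    exact run_append.2 ⟨_, run_replicate_inc _, _, ⟨by simp, rfl⟩, by simpa using h⟩

end CounterProgram

open CounterAction CounterProgram TraceSymbol in
/-- Totality of context-free languages is at least as hard as the complement of any recursively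
enumerable set. -/
theorem exists_language_eq_univ_iff {f : ℕ →. ℕ} (hf : Partrec f) :
    ∃ G : ℕ → EncCFG, Computable G ∧
      ∀ n, (toCFG (G n)).language = Set.univ ↔ ¬ (f n).Dom := by
  obtain ⟨p, hp⟩ := exists_rel_iff_dom hf
  obtain ⟨σ, _, M, hM⟩ := p.withInput.isRegular_encodedTraces.compl
  obtain ⟨K₀, hK₀⟩ := p.withInput.exists_counter_lt
  let K := K₀ + 1
  have hK : ∀ t ∈ p.withInput.traces, ∀ a ∈ t, a.counter < K := fun t ht a ha =>
    (hK₀ t ht a ha).trans (Nat.lt_succ_self _)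
  obtain ⟨e, he⟩ := Countable.exists_injective_nat σ
  let fixed := (finite_isRule M K).toFinset.toList
  have hfixed : ∀ r, r ∈ fixed ↔ IsRule M K r := by simp [fixed]
  refine ⟨fun n => (code e start, (inputRules n ++ fixed).map (encodeRule (code e))), ?_, ?_⟩
  · let c₁ : ℕ ⊕ Fin 2 := .inl (code e opt)
    let c₂ : ℕ ⊕ Fin 2 := .inl (code e (action (move true 0)))
    have hrep : ∀ c : ℕ ⊕ Fin 2, Primrec fun n => List.replicate n c := fun c =>
      (Primrec.list_map Primrec.list_range (Primrec₂.const c)).of_eq fun n => by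
        simp [List.map_const']
    have hrule : ∀ (c : ℕ ⊕ Fin 2) (m : ℕ) (l : List (ℕ ⊕ Fin 2)),
        Primrec fun n => (code e start, List.replicate (n + m) c ++ l) := fun c m l =>
      Primrec.pair (Primrec.const _) (Primrec.list_append.comp
        ((hrep c).comp (Primrec.nat_add.comp Primrec.id (Primrec.const m))) (Primrec.const l))
    refine Primrec.to_comp ?_
    refine (Primrec.pair (Primrec.const (code e start)) <| Primrec.list_cons.comp
      (hrule c₁ 0 [.inl (code e (action (move false 0))), .inl (code e any)]) <|
      Primrec.list_cons.comp (hrule c₂ 2 [.inl (code e any)])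
        (Primrec.const (fixed.map (encodeRule (code e))))).of_eq fun n => ?_
    simp [inputRules, encodeRule, c₁, c₂]
  · intro n
    obtain ⟨J, hJS, hJ, hleast⟩ :=
      exists_least_closed (code_injective he) start (inputRules n ++ fixed)
    rw [← hJS]
    have hJr : ∀ r, IsRule M K r → Closed J r := fun r hr =>
      hJ r (List.mem_append_right _ ((hfixed r).2 hr))
    rw [← hp]
    constructor
    · rintro huniv ⟨s, t, ht, hrun⟩
      have hrun := run_input_iff.2 hrun
      set u := List.replicate (n + 1) (move true 0) ++ move false 0 :: t with hu
      have hmem : u ∈ p.withInput.traces := mem_traces_withInput.2 ⟨n + 1, t, ht, hu⟩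
      have hacc : encodeTrace u ∉ M.accepts := by
        rw [hM]
        exact fun h => h ⟨u, hmem, rfl⟩
      have := hleast (avoiding M (encodeTrace u)) (fun r hr => ?_) start
        (show encodeTrace u ∈ J start from huniv ▸ Set.mem_univ (encodeTrace u))
      · exact this rfl
      · rcases List.mem_append.1 hr with hr | hr
        · exact closed_avoiding_inputRules M t hr
        · exact closed_avoiding hrun hacc ((hfixed r).1 hr)
    · intro hnot
      refine Set.eq_univ_of_forall fun w => ?_
      by_contra hw
      have hw' : w ∈ p.withInput.encodedTraces := by
        by_contra h
        have h' : w ∈ M.acceptsFrom M.start := by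
          change w ∈ M.accepts
          rw [hM]
          exact h
        exact hw (hJr _ .start_state ⟨w, mem_state hJr h', _, rfl, List.append_nil _⟩)
      obtain ⟨u, hu, rfl⟩ := hw'
      obtain ⟨j, t, ht, rfl⟩ := mem_traces_withInput.1 hu
      obtain rfl : j = n + 1 := by
        by_contra hj
        exact hw (mem_start_of_ne K₀.succ_pos hJr
          (fun r hr => hJ r (List.mem_append_left _ hr)) hj t)
      obtain ⟨s, hs⟩ | ⟨x, a, y, hxy, hb⟩ := exists_run_or_blocked
        (List.replicate (n + 1) (move true 0) ++ move false 0 :: t)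
      · exact hnot ⟨s, t, ht, run_input_iff.1 hs⟩
      · rw [hxy] at hw hu
        exact hw (mem_start_of_blocked hJr (hK _ hu) hb)

/-- Totality of context-free languages is undecidable. -/
theorem not_exists_computable_language_eq_univ :
    ¬ ∃ f : EncCFG → Bool, Computable f ∧
      ∀ G : EncCFG, (f G = true ↔ (toCFG G).language = Set.univ) := by
  rintro ⟨f, hf, hfG⟩
  have hpart : Partrec fun k : ℕ => (Denumerable.ofNat Nat.Partrec.Code k).eval 0 :=
    Nat.Partrec.Code.eval_part.comp (Computable.ofNat _) (Computable.const 0)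
  obtain ⟨G, hG, hdom⟩ := exists_language_eq_univ_iff hpart
  refine ComputablePred.halting_problem 0 (ComputablePred.computable_iff.2
    ⟨fun c => !f (G (Encodable.encode c)),
      Primrec.not.to_comp.comp (hf.comp (hG.comp Computable.encode)), ?_⟩)
  funext c
  have h := (hfG _).trans (hdom (Encodable.encode c))
  rw [Denumerable.ofNat_encode] at h
  refine propext ?_
  cases hb : f (G (Encodable.encode c)) <;> simp_all

section FreeEnergy

theorem card_words_le (K : Set (List (Fin 2))) (n : ℕ) :
    Nat.card {w : List (Fin 2) // w ∈ K ∧ w.length = n} ≤ 2 ^ n := by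
  have h : Nat.card (List.Vector (Fin 2) n) = 2 ^ n := by
    rw [Nat.card_eq_fintype_card, card_vector, Fintype.card_fin]
  rw [← h]
  exact Nat.card_le_card_of_injective
    (fun w => (⟨w.1, w.2.2⟩ : List.Vector (Fin 2) n)) fun w w' h => Subtype.ext (congrArg (·.1) h)

theorem le_card_words_compCat {L : Set (List (Fin 2))} {u : List (Fin 2)} (hu : u ∉ L) (n : ℕ) :
    2 ^ n ≤ Nat.card {w : List (Fin 2) // w ∈ compCat L ∧ w.length = u.length + n} := by
  have h : Nat.card (List.Vector (Fin 2) n) = 2 ^ n := by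
    rw [Nat.card_eq_fintype_card, card_vector, Fintype.card_fin]
  have : Finite {w : List (Fin 2) // w ∈ compCat L ∧ w.length = u.length + n} :=
    Finite.of_injective (β := List.Vector (Fin 2) (u.length + n)) (fun w => ⟨w.1, w.2.2⟩)
      fun w w' h => Subtype.ext (congrArg (·.1) h)
  rw [← h]
  exact Nat.card_le_card_of_injective
    (fun v : List.Vector (Fin 2) n =>
      (⟨u ++ v.1, ⟨u, v.1, hu, rfl⟩, by simp [v.2]⟩ :
        {w : List (Fin 2) // w ∈ compCat L ∧ w.length = u.length + n}))
    fun v v' h => Subtype.ext (List.append_cancel_left (congrArg (·.1) h))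

theorem freeEnergyZero_empty : freeEnergyZero (∅ : Set (List (Fin 2))) = 0 := by
  simp [freeEnergyZero]

theorem compCat_univ {σ : Type*} : compCat (Set.univ : Set (List σ)) = ∅ := by
  simp [compCat]

theorem freeEnergyZero_compCat_of_ne_univ {L : Set (List (Fin 2))} (hL : L ≠ Set.univ) :
    freeEnergyZero (compCat L) = Real.log 2 := by
  obtain ⟨u, hu⟩ := (Set.ne_univ_iff_exists_notMem L).1 hL
  refine Tendsto.limsup_eq ?_
  have hlim : Tendsto (fun n : ℕ => Real.log 2 - u.length * Real.log 2 * (1 / (n : ℝ))) atTop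
      (nhds (Real.log 2)) := by
    simpa using tendsto_const_nhds.sub
      (tendsto_one_div_atTop_nhds_zero_nat.const_mul (u.length * Real.log 2))
  refine tendsto_of_tendsto_of_tendsto_of_le_of_le' hlim tendsto_const_nhds ?_ ?_
  · filter_upwards [eventually_ge_atTop (u.length + 1)] with n hn
    obtain ⟨m, rfl⟩ := Nat.exists_eq_add_of_le (Nat.le_of_succ_le hn)
    have hpos : (0 : ℝ) < (u.length + m : ℕ) := by exact_mod_cast (by omega)
    have hcard : (2 : ℝ) ^ m ≤
        Nat.card {w : List (Fin 2) // w ∈ compCat L ∧ w.length = u.length + m} := by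
      exact_mod_cast le_card_words_compCat hu m
    have hlog := Real.log_le_log (by positivity) hcard
    rw [Real.log_pow] at hlog
    refine le_trans (le_of_eq ?_) (mul_le_mul_of_nonneg_left hlog (by positivity))
    field_simp
    push_cast
    ring
  · filter_upwards [eventually_ge_atTop 1] with n hn
    have hpos : (0 : ℝ) < n := by exact_mod_cast hn
    have hlog : Real.log (Nat.card {w : List (Fin 2) // w ∈ compCat L ∧ w.length = n}) ≤
        n * Real.log 2 := by
      rw [← Real.log_pow]
      rcases Nat.eq_zero_or_pos
        (Nat.card {w : List (Fin 2) // w ∈ compCat L ∧ w.length = n}) with h | h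
      · rw [h, Nat.cast_zero, Real.log_zero]
        exact Real.log_nonneg (one_le_pow₀ one_le_two)
      · exact Real.log_le_log (by exact_mod_cast h) (by exact_mod_cast card_words_le _ n)
    rw [one_div, inv_mul_le_iff₀ hpos]
    exact hlog

theorem freeEnergyZero_compCat_eq_zero_iff {L : Set (List (Fin 2))} :
    freeEnergyZero (compCat L) = 0 ↔ L = Set.univ := by
  refine ⟨fun h => by_contra fun hL => ?_, ?_⟩
  · rw [freeEnergyZero_compCat_of_ne_univ hL] at h
    exact (Real.log_pos one_lt_two).ne' h
  · rintro rfl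
    rw [compCat_univ, freeEnergyZero_empty]

end FreeEnergy

/-- totality of context-free languages is undecidable, hence the free
energy (with zero cost) of L' = (Σ*−L)Σ* is not computable from a grammar for L:
no computable procedure can even decide whether this free energy is 0
(and, L' having free energy 0 or ln 2 only, deciding "= 0" amounts to computing it). -/
theorem stmt5 :
    (¬ ∃ f : EncCFG → Bool, Computable f ∧
        ∀ G : EncCFG, (f G = true ↔ (toCFG G).language = Set.univ)) ∧
    (¬ ∃ f : EncCFG → Bool, Computable f ∧
        ∀ G : EncCFG,
          (f G = true ↔ freeEnergyZero (compCat ((toCFG G).language : Set (List (Fin 2)))) = 0)) := by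
  refine ⟨not_exists_computable_language_eq_univ, ?_⟩
  rintro ⟨f, hf, hfG⟩
  exact not_exists_computable_language_eq_univ
    ⟨f, hf, fun G => (hfG G).trans freeEnergyZero_compCat_eq_zero_iff⟩
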